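/- arXiv:2203.12006 — 2 statements merged into one kernel-verified Lean document; each statement's English description precedes it below -/
import Mathlib

section
/- Let c > 0, T ≥ 3, let χ be a non-principal Dirichlet character modulo k, and suppose L(s, χ) has no zeros in the region {s = σ + it : σ ≥ 1 − 3c/log(kT), |t| ≤ 2T}. Let log L(s, χ) denote the analytic branch of the logarithm of L(s, χ) on this zero-free region which equals Σ_{p prime} Σ_{m≥1} χ(p)^m/(m·p^{ms}) for Re s > 1. Then there is a constant C (depending only on c) such that |log L(s, χ)| ≤ C·log log(kT) for every s on the boundary of the region {σ ≥ 1 − c/log(kT), |t| ≤ T}. -/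
/-- The series `Σ_{q prime} Σ_{m ≥ 1} χ(q)^m / (m·q^{ms})`, which equals `log L(s, χ)`
for `Re s > 1`. -/
noncomputable def logLSeries {k : ℕ} (χ : DirichletCharacter ℂ k) (s : ℂ) : ℂ :=
  ∑' (q : Nat.Primes) (m : ℕ),
    χ (((q : ℕ) : ZMod k)) ^ (m + 1) / ((m + 1) * ((q : ℕ) : ℂ) ^ (((m : ℂ) + 1) * s))


/-- partial sums over `range` of a nonprincipal character are bounded by `k`. -/
lemma charsum_range_le {k : ℕ} [NeZero k] (χ : DirichletCharacter ℂ k) (hχ : χ ≠ 1) (n : ℕ) :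
    ‖∑ i ∈ Finset.range n, χ ((i : ℕ) : ZMod k)‖ ≤ k := by
  have hk : 0 < k := Nat.pos_of_ne_zero (NeZero.ne k)
  have h0 : ∑ i ∈ Finset.range k, χ ((i : ℕ) : ZMod k) = 0 := by
    rw [← MulChar.sum_eq_zero_of_ne_one hχ]
    refine Finset.sum_bij' (fun i _ => ((i : ℕ) : ZMod k)) (fun a _ => a.val) ?_ ?_ ?_ ?_ ?_
    · simp
    · intro a _; simpa using ZMod.val_lt a
    · intro a ha; simpa using ZMod.val_cast_of_lt (Finset.mem_range.1 ha)
    · intro a _; simp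
    · intro a _; rfl
  induction n using Nat.strong_induction_on with
  | _ n ih =>
    by_cases h : n < k
    · refine (norm_sum_le _ _).trans ?_
      refine (Finset.sum_le_sum (fun i _ => χ.norm_le_one _)).trans ?_
      simp; exact_mod_cast h.le
    · push Not at h
      obtain ⟨m, rfl⟩ := Nat.exists_eq_add_of_le h
      rw [Finset.sum_range_add, h0, zero_add]
      simpa using ih m (by omega)

lemma zeta_norm_le {d : ℝ} (hd : 0 < d) : ‖riemannZeta ((1 + d : ℝ) : ℂ)‖ ≤ 1 + 1 / d := by
  have h1 : (1:ℝ) < 1 + d := by linarith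
  have := ZetaAsymptotics.zeta_limit_aux1 h1
  have h2 : 0 ≤ ZetaAsymptotics.termTSum (1 + d) :=
    tsum_nonneg (fun n => ZetaAsymptotics.term_nonneg _ _)
  rw [zeta_eq_tsum_one_div_nat_add_one_cpow (by simpa using hd)]
  have h3 : (∑' n : ℕ, 1 / ((n : ℂ) + 1) ^ ((1 + d : ℝ) : ℂ))
      = ((∑' n : ℕ, 1 / ((n : ℝ) + 1) ^ (1 + d) : ℝ) : ℂ) := by
    rw [Complex.ofReal_tsum]
    congr 1; ext n
    rw [Complex.ofReal_div, Complex.ofReal_cpow (by positivity)]; simp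
  rw [h3, Complex.norm_real, Real.norm_of_nonneg (tsum_nonneg fun n => by positivity)]
  have : 0 ≤ (1 + d) * ZetaAsymptotics.termTSum (1 + d) := by positivity
  simp only [add_sub_cancel_left] at *
  linarith

lemma logLSeries_norm_le {k : ℕ} (χ : DirichletCharacter ℂ k) {d : ℝ} (hd : 0 < d) {s : ℂ}
    (hs : 1 + d ≤ s.re) : ‖logLSeries χ s‖ ≤ Real.log (1 + 1 / d) := by
  have hq1 (q : Nat.Primes) : (1:ℝ) < (q : ℕ) := by exact_mod_cast q.prop.one_lt
  set x : Nat.Primes → ℝ := fun q => ((q : ℕ) : ℝ) ^ (-(1 + d)) with hx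
  have hx0 q : 0 < x q := by have := hq1 q; positivity
  have hx1 q : x q < 1 := Real.rpow_lt_one_of_one_lt_of_neg (hq1 q) (by linarith)
  have hz (q : Nat.Primes) : ‖χ (((q : ℕ) : ZMod k)) * ((q : ℕ) : ℂ) ^ (-s)‖ ≤ x q := by
    rw [norm_mul, Complex.norm_natCast_cpow_of_pos q.prop.pos]
    refine (mul_le_of_le_one_left (by positivity) (χ.norm_le_one _)).trans ?_
    exact Real.rpow_le_rpow_of_exponent_le (hq1 q).le (by simp; linarith)
  have hreal q := Real.hasSum_pow_div_log_of_abs_lt_one (x := x q)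
    (by rw [abs_of_pos (hx0 q)]; exact hx1 q)
  have hcast (q : Nat.Primes) : -Complex.log (1 - ((q : ℕ) : ℂ) ^ (-((1 + d : ℝ) : ℂ)))
      = ((-Real.log (1 - x q) : ℝ) : ℂ) := by
    rw [Complex.ofReal_neg, Complex.ofReal_log (by linarith [hx1 q])]
    simp only [hx]
    rw [Complex.ofReal_sub, Complex.ofReal_cpow (by positivity)]; simp
  have hsumC := DirichletCharacter.summable_neg_log_one_sub_mul_prime_cpow (N := 1) 1
    (s := ((1 + d : ℝ) : ℂ)) (by simpa using hd)
  have hsum : Summable (fun q => -Real.log (1 - x q)) := by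
    rw [← Complex.summable_ofReal]
    refine hsumC.congr fun q => ?_
    rw [← hcast, MulChar.one_apply (isUnit_of_subsingleton _), one_mul]
  have hzeta : Real.exp (∑' q, -Real.log (1 - x q)) ≤ 1 + 1 / d := by
    have := riemannZeta_eulerProduct_exp_log (s := ((1 + d : ℝ) : ℂ)) (by simpa using hd)
    simp_rw [hcast] at this
    rw [← Complex.ofReal_tsum] at this
    have h2 := zeta_norm_le hd
    rw [← this, Complex.norm_exp, Complex.ofReal_re] at h2
    exact h2
  have hle : ∑' q, -Real.log (1 - x q) ≤ Real.log (1 + 1 / d) := by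
    rwa [Real.le_log_iff_exp_le (by positivity)]
  refine le_trans ?_ hle
  unfold logLSeries
  refine tsum_of_norm_bounded hsum.hasSum fun q => ?_
  refine tsum_of_norm_bounded (hreal q) fun m => ?_
  have he : χ (((q : ℕ) : ZMod k)) ^ (m + 1) / ((m + 1) * ((q : ℕ) : ℂ) ^ (((m : ℂ) + 1) * s))
      = (χ (((q : ℕ) : ZMod k)) * ((q : ℕ) : ℂ) ^ (-s)) ^ (m + 1) / ((m + 1 : ℕ) : ℂ) := by
    rw [mul_pow, ← Complex.cpow_nat_mul, mul_neg, Complex.cpow_neg]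
    push_cast
    rw [← div_eq_mul_inv, div_div, mul_comm]
  rw [he, norm_div, norm_pow, Complex.norm_natCast]
  push_cast
  gcongr
  exact hz q

lemma bc_step {g : ℂ → ℂ} {M B d : ℝ} (hM : 0 < M) (hd : 0 < d) {s : ℂ}
    (hg : DifferentiableOn ℂ g (Metric.ball (s + d) (2 * d)))
    (hre : ∀ w ∈ Metric.ball (s + (d:ℂ)) (2 * d), (g w).re ≤ M)
    (hB : ‖g (s + d)‖ ≤ B) : ‖g s‖ ≤ 2 * M + 3 * B := by
  have hmap : Set.MapsTo (fun z : ℂ => s + d + z) (Metric.ball 0 (2 * d))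
      (Metric.ball (s + (d:ℂ)) (2 * d)) := by
    intro z hz; simpa [Metric.mem_ball, dist_eq_norm] using hz
  have := Complex.borelCaratheodory (f := fun z => g (s + d + z)) (R := 2 * d) (z := -(d:ℂ)) hM
    (hg.comp (by fun_prop) hmap) (fun z hz => hre _ (hmap hz)) (by linarith)
    (by simp [abs_of_pos hd]; linarith)
  simp only [add_neg_cancel_right, norm_neg, Complex.norm_real, Real.norm_of_nonneg hd.le,
    add_zero] at this
  have e : 2 * d - d = d := by ring
  have e2 : 2 * d + d = 3 * d := by ring
  rw [e, e2, mul_div_assoc, mul_div_assoc, div_self hd.ne', mul_div_assoc, div_self hd.ne'] at this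
  linarith

open Asymptotics Filter Topology MeasureTheory in
lemma LFunction_repr {k : ℕ} [NeZero k] (χ : DirichletCharacter ℂ k) (hχ : χ ≠ 1) {N : ℕ}
    (hN : 1 ≤ N) {s : ℂ} (hs : 0 < s.re) :
    ∃ S : ℝ → ℂ, (∀ t, ‖S t‖ ≤ 2 * k) ∧ (∀ t : ℝ, t ≤ N → S t = 0) ∧
      DirichletCharacter.LFunction χ s = ∑ n ∈ Finset.Icc 1 N, χ ((n : ℕ) : ZMod k) * (n : ℂ) ^ (-s)
        + s * ∫ t in Set.Ioi (N : ℝ), (t : ℂ) ^ (-s - 1) * S t := by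
  set f : ℕ → ℂ := fun j => if j ≤ N then 0 else χ ((j : ℕ) : ZMod k) with hf
  set h : ℕ → ℂ := fun j => if j ≤ N then χ ((j : ℕ) : ZMod k) else 0 with hh
  set F : ℕ → ℂ := fun n => ∑ j ∈ Finset.Icc 1 n, f j with hF
  have hF0 : ∀ n ≤ N, F n = 0 := fun n hn => Finset.sum_eq_zero fun j hj => by
    simp only [hf]; rw [if_pos]; exact (Finset.mem_Icc.1 hj).2.trans hn
  have hFb : ∀ n, ‖F n‖ ≤ 2 * k := by
    intro n
    by_cases hn : n ≤ N
    · rw [hF0 n hn]; simp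
    · push Not at hn
      have : F n = ∑ i ∈ Finset.range (n + 1), χ ((i : ℕ) : ZMod k)
          - ∑ i ∈ Finset.range (N + 1), χ ((i : ℕ) : ZMod k) := by
        rw [← Finset.sum_Ico_eq_sub _ (by omega)]
        simp only [hF, hf]
        rw [← Finset.sum_filter_add_sum_filter_not (Finset.Icc 1 n) (fun j => j ≤ N)]
        rw [Finset.sum_eq_zero (fun j hj => if_pos (Finset.mem_filter.1 hj).2), zero_add]
        rw [Finset.sum_congr rfl (fun j hj => if_neg (Finset.mem_filter.1 hj).2)]
        refine Finset.sum_congr ?_ fun _ _ => rfl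
        ext j; simp only [Finset.mem_filter, Finset.mem_Icc, Finset.mem_Ico]; omega
      rw [this]
      refine (norm_sub_le _ _).trans ?_
      linarith [charsum_range_le χ hχ (n + 1), charsum_range_le χ hχ (N + 1)]
  set S : ℝ → ℂ := fun t => F ⌊t⌋₊ with hS
  have hSb : ∀ t, ‖S t‖ ≤ 2 * k := fun t => hFb _
  have hS0 : ∀ t : ℝ, t ≤ N → S t = 0 := fun t ht => hF0 _ (Nat.floor_le_of_le ht)
  have hSm : Measurable S := (measurable_from_nat (f := F)).comp Nat.measurable_floor
  refine ⟨S, hSb, hS0, ?_⟩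
  have hmel : ∀ M : ℕ, M ≤ N → ∀ z : ℂ,
      mellin S (-z) = ∫ t in Set.Ioi (M : ℝ), (t : ℂ) ^ (-z - 1) * S t := by
    intro M hM z
    unfold mellin
    simp only [smul_eq_mul]
    refine setIntegral_eq_of_subset_of_forall_sdiff_eq_zero (μ := volume)
      (f := fun t : ℝ => (t : ℂ) ^ (-z - 1) * S t) (s := Set.Ioi (M:ℝ)) (t := Set.Ioi (0:ℝ))
      measurableSet_Ioi (Set.Ioi_subset_Ioi (Nat.cast_nonneg M)) fun t ht => ?_
    rw [hS0 t ?_, mul_zero]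
    have : t ≤ M := by simpa using ht.2
    exact this.trans (by exact_mod_cast hM)
  have hdiff : ∀ z : ℂ, 0 < z.re → DifferentiableAt ℂ (fun z => mellin S (-z)) z := by
    intro z hz
    have := mellin_differentiableAt_of_isBigO_rpow (f := S) (s := -z) (a := 0)
      (b := -z.re - 1) ?_ ?_ (by simpa using hz) ?_ (by simp)
    · exact DifferentiableAt.comp (g := mellin S) (f := fun z : ℂ => -z) z this (by fun_prop)
    · refine (locallyIntegrableOn_const (2 * k : ℂ)).mono hSm.aestronglyMeasurable ?_
      exact Eventually.of_forall fun t => by simpa using hSb t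
    · simp only [neg_zero, Real.rpow_zero]
      exact IsBigO.of_bound (2 * k) (Eventually.of_forall fun t => by simpa using hSb t)
    · refine IsBigO.of_bound 1 ?_
      have : ∀ᶠ t : ℝ in 𝓝[>] 0, t < N := 
        nhdsWithin_le_nhds (Iio_mem_nhds (by exact_mod_cast hN))
      filter_upwards [this] with t ht
      rw [hS0 t ht.le]; simp
  set G : ℂ → ℂ := fun z => ∑ n ∈ Finset.Icc 1 N, χ ((n : ℕ) : ZMod k) * (n : ℂ) ^ (-z)
        + z * mellin S (-z) with hG
  have hGd : DifferentiableOn ℂ G {z : ℂ | 0 < z.re} := by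
    intro z hz
    refine DifferentiableAt.differentiableWithinAt ?_
    refine DifferentiableAt.add ?_ (differentiableAt_id.mul (hdiff z hz))
    refine DifferentiableAt.fun_sum fun n hn => ?_
    refine DifferentiableAt.const_mul ?_ _
    refine DifferentiableAt.const_cpow (by fun_prop) (Or.inl ?_)
    have := (Finset.mem_Icc.1 hn).1
    exact_mod_cast (by omega : n ≠ 0)
  have hopen : IsOpen {z : ℂ | 0 < z.re} := isOpen_lt continuous_const Complex.continuous_re
  have hopen1 : IsOpen {z : ℂ | 1 < z.re} := isOpen_lt continuous_const Complex.continuous_re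
  have heq1 : ∀ z : ℂ, 1 < z.re → DirichletCharacter.LFunction χ z = G z := by
    intro z hz
    rw [DirichletCharacter.LFunction_eq_LSeries χ hz]
    have hsχ : LSeriesSummable (fun n => χ ((n : ℕ) : ZMod k)) z :=
      ZMod.LSeriesSummable_of_one_lt_re χ hz
    have hsh : LSeriesHasSum h z (∑ n ∈ Finset.Icc 1 N, χ ((n : ℕ) : ZMod k) * (n : ℂ) ^ (-z)) := by
      have h1 : LSeriesHasSum h z (∑ n ∈ Finset.Icc 1 N, LSeries.term h z n) := by
        refine hasSum_sum_of_ne_finset_zero fun n hn => ?_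
        rcases Nat.eq_zero_or_pos n with rfl | hp
        · simp
        · rw [LSeries.term_of_ne_zero hp.ne']
          have : ¬ n ≤ N := fun hle => hn (Finset.mem_Icc.2 ⟨hp, hle⟩)
          simp [hh, this]
      convert h1 using 1
      refine Finset.sum_congr rfl fun n hn => ?_
      have := Finset.mem_Icc.1 hn
      rw [LSeries.term_of_ne_zero (by omega), Complex.cpow_neg, div_eq_mul_inv]
      simp [hh, this.2]
    have hfe : f = (fun n => χ ((n : ℕ) : ZMod k)) - h := by
      ext j; simp only [hf, hh, Pi.sub_apply]; split_ifs <;> simp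
    have hsf : LSeriesSummable f z := by rw [hfe]; exact hsχ.sub hsh.LSeriesSummable
    have h2 : LSeries f z = LSeries (fun n => χ ((n : ℕ) : ZMod k)) z
        - ∑ n ∈ Finset.Icc 1 N, χ ((n : ℕ) : ZMod k) * (n : ℂ) ^ (-z) := by
      rw [hfe, LSeries_sub hsχ hsh.LSeriesSummable, hsh.LSeries_eq]
    have h3 := LSeries_eq_mul_integral f le_rfl (by linarith : 0 < z.re) hsf
      (by
        simp only [Real.rpow_zero]
        exact IsBigO.of_bound (2 * k) (Eventually.of_forall fun n => by simpa using hFb n))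
    have h4 : mellin S (-z) = ∫ t in Set.Ioi (1 : ℝ),
        (∑ k ∈ Finset.Icc 1 ⌊t⌋₊, f k) * (t : ℂ) ^ (-(z + 1)) := by
      rw [hmel 1 hN z, Nat.cast_one]
      refine setIntegral_congr_fun measurableSet_Ioi fun t _ => ?_
      simp only [hS, hF]
      rw [mul_comm, show -(z + 1) = -z - 1 by ring]
    simp only [hG]
    rw [h4, ← h3, h2]; ring
  have hmain : Set.EqOn (DirichletCharacter.LFunction χ) G {z : ℂ | 0 < z.re} := by
    refine AnalyticOnNhd.eqOn_of_preconnected_of_eventuallyEq (z₀ := 2)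
      ((DirichletCharacter.differentiable_LFunction hχ).differentiableOn.analyticOnNhd hopen)
      (hGd.analyticOnNhd hopen) (convex_halfSpace_re_gt 0).isPreconnected (by simp) ?_
    filter_upwards [hopen1.mem_nhds (show (2:ℂ) ∈ {z : ℂ | 1 < z.re} by simp)] with z hz
    exact heq1 z hz
  rw [hmain hs, hG]
  simp only
  rw [hmel N le_rfl s]

open MeasureTheory in
lemma LFunction_norm_le {k : ℕ} [NeZero k] (χ : DirichletCharacter ℂ k) (hχ : χ ≠ 1) {N : ℕ}
    (hN : 1 ≤ N) {s : ℂ} (hs : 0 < s.re) :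
    ‖DirichletCharacter.LFunction χ s‖ ≤ ∑ n ∈ Finset.Icc 1 N, (n : ℝ) ^ (-s.re)
      + ‖s‖ * (2 * k * ((N : ℝ) ^ (-s.re) / s.re)) := by
  obtain ⟨S, hSb, hS0, he⟩ := LFunction_repr χ hχ hN hs
  have hN0 : (0:ℝ) < N := by exact_mod_cast hN
  rw [he]
  refine (norm_add_le _ _).trans ?_
  rw [norm_mul]
  gcongr
  · refine (norm_sum_le _ _).trans (Finset.sum_le_sum fun n hn => ?_)
    rw [norm_mul, Complex.norm_natCast_cpow_of_pos (Finset.mem_Icc.1 hn).1]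
    exact mul_le_of_le_one_left (by positivity) (χ.norm_le_one _)
  · have hlt : -s.re - 1 < -1 := by linarith
    have hval : ∫ t in Set.Ioi (N:ℝ), 2 * k * t ^ (-s.re - 1)
        = 2 * k * ((N : ℝ) ^ (-s.re) / s.re) := by
      rw [integral_const_mul, integral_Ioi_rpow_of_lt hlt hN0]
      rw [show -s.re - 1 + 1 = -s.re by ring, neg_div_neg_eq]
    rw [← hval]
    refine norm_integral_le_of_norm_le ((integrableOn_Ioi_rpow_of_lt hlt hN0).const_mul _) ?_
    filter_upwards [ae_restrict_mem measurableSet_Ioi] with t ht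
    have ht0 : 0 < t := hN0.trans ht
    rw [norm_mul, Complex.norm_cpow_eq_rpow_re_of_pos ht0, mul_comm]
    simp only [Complex.sub_re, Complex.neg_re, Complex.one_re]
    gcongr
    exact hSb t

lemma L_explicit {c T : ℝ} (hc : 0 < c) (hT : 3 ≤ T) {k : ℕ} [NeZero k]
    (χ : DirichletCharacter ℂ k) (hχ : χ ≠ 1) (hL : 1 ≤ Real.log (k * T)) {s : ℂ}
    (h1 : 1 - 3 * c / Real.log (k * T) ≤ s.re) (h2 : 1 / 2 ≤ s.re) (h3 : s.re ≤ 2)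
    (h4 : |s.im| ≤ 2 * T) :
    ‖DirichletCharacter.LFunction χ s‖ ≤ 34 * Real.exp (3 * c) * Real.log (k * T) := by
  have hk : (1:ℝ) ≤ k := by exact_mod_cast Nat.pos_of_ne_zero (NeZero.ne k)
  set Y : ℝ := k * T with hY
  set L := Real.log Y with hLd
  set E := Real.exp (3 * c) with hE
  have hE0 : 0 < E := Real.exp_pos _
  have hY3 : 3 ≤ Y := by nlinarith
  have hY0 : 0 < Y := by linarith
  set N := ⌊Y⌋₊ with hN
  have hNle : (N:ℝ) ≤ Y := Nat.floor_le hY0.le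
  have hNge : Y < N + 1 := Nat.lt_floor_add_one Y
  have hN2 : Y / 2 ≤ N := by linarith
  have hN1 : 1 ≤ N := by
    have : (0:ℝ) < N := by linarith
    exact_mod_cast this
  have hpow : ∀ n : ℕ, 1 ≤ n → n ≤ N → (n:ℝ) ^ (-s.re) ≤ E * (n:ℝ)⁻¹ := by
    intro n hn1 hn2
    have hn0 : (0:ℝ) < n := by exact_mod_cast hn1
    have hn1' : (1:ℝ) ≤ n := by exact_mod_cast hn1
    have hnY : (n:ℝ) ≤ Y := le_trans (by exact_mod_cast hn2) hNle
    rw [show -s.re = (1 - s.re) + (-1) by ring, Real.rpow_add hn0, Real.rpow_neg_one]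
    gcongr
    rw [Real.rpow_def_of_pos hn0]
    apply Real.exp_le_exp.2
    have hl0 : 0 ≤ Real.log n := Real.log_nonneg hn1'
    have hl1 : Real.log n ≤ L := Real.log_le_log hn0 hnY
    have hq : 0 ≤ 3 * c / L := by positivity
    calc Real.log n * (1 - s.re) ≤ Real.log n * (3 * c / L) := by
          apply mul_le_mul_of_nonneg_left _ hl0; linarith
      _ ≤ L * (3 * c / L) := by gcongr
      _ = 3 * c := by field_simp
  have hsn : ‖s‖ ≤ 4 * T := by
    refine (Complex.norm_le_abs_re_add_abs_im s).trans ?_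
    rw [abs_of_nonneg (by linarith)]; linarith
  refine (LFunction_norm_le χ hχ hN1 (by linarith)).trans ?_
  have hsum : ∑ n ∈ Finset.Icc 1 N, (n : ℝ) ^ (-s.re) ≤ E * (1 + L) := by
    have hh := harmonic_floor_le_one_add_log Y (by linarith)
    rw [harmonic_eq_sum_Icc] at hh
    push_cast at hh
    calc ∑ n ∈ Finset.Icc 1 N, (n : ℝ) ^ (-s.re) ≤ ∑ n ∈ Finset.Icc 1 N, E * (n:ℝ)⁻¹ :=
          Finset.sum_le_sum fun n hn => hpow n (Finset.mem_Icc.1 hn).1 (Finset.mem_Icc.1 hn).2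
      _ = E * ∑ n ∈ Finset.Icc 1 N, (n:ℝ)⁻¹ := by rw [Finset.mul_sum]
      _ ≤ E * (1 + L) := by gcongr
  have hlast : ‖s‖ * (2 * k * ((N : ℝ) ^ (-s.re) / s.re)) ≤ 32 * E := by
    have hb : (N : ℝ) ^ (-s.re) / s.re ≤ (E * (Y / 2)⁻¹) / (1 / 2) := by
      have := hpow N hN1 le_rfl
      have h5 : (N:ℝ)⁻¹ ≤ (Y / 2)⁻¹ := inv_anti₀ (by positivity) hN2
      have h6 : (N : ℝ) ^ (-s.re) ≤ E * (Y / 2)⁻¹ := this.trans (by gcongr)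
      gcongr
    calc ‖s‖ * (2 * k * ((N : ℝ) ^ (-s.re) / s.re))
        ≤ (4 * T) * (2 * k * ((E * (Y / 2)⁻¹) / (1 / 2))) := by gcongr
      _ = 32 * E := by rw [hY]; field_simp; ring
  nlinarith

lemma L_compact (K : ℕ) (a b R : ℝ) : ∃ M : ℝ, 0 ≤ M ∧ ∀ (k : ℕ) [NeZero k]
    (χ : DirichletCharacter ℂ k), χ ≠ 1 → k ≤ K → ∀ s : ℂ, a ≤ s.re → s.re ≤ b → |s.im| ≤ R →
    ‖DirichletCharacter.LFunction χ s‖ ≤ M := by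
  have hcomp : IsCompact ((Set.Icc a b) ×ℂ (Set.Icc (-R) R)) :=
    isCompact_Icc.reProdIm isCompact_Icc
  have h1 : ∀ k : ℕ, ∃ M : ℝ, 0 ≤ M ∧ ∀ [NeZero k] (χ : DirichletCharacter ℂ k), χ ≠ 1 →
      ∀ s ∈ ((Set.Icc a b) ×ℂ (Set.Icc (-R) R)), ‖DirichletCharacter.LFunction χ s‖ ≤ M := by
    intro k
    by_cases hk : NeZero k
    · have h2 : ∀ χ : DirichletCharacter ℂ k, ∃ M : ℝ, 0 ≤ M ∧ (χ ≠ 1 →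
          ∀ s ∈ ((Set.Icc a b) ×ℂ (Set.Icc (-R) R)), ‖DirichletCharacter.LFunction χ s‖ ≤ M) := by
        intro χ
        by_cases hχ : χ = 1
        · exact ⟨0, le_rfl, fun h => absurd hχ h⟩
        · obtain ⟨M, hM⟩ := hcomp.exists_bound_of_continuousOn
            (DirichletCharacter.differentiable_LFunction hχ).continuous.continuousOn
          exact ⟨max M 0, le_max_right _ _, fun _ s hs => (hM s hs).trans (le_max_left _ _)⟩
      choose m hm0 hm using h2
      have : Finite (DirichletCharacter ℂ k) := inferInstance
      have := Fintype.ofFinite (DirichletCharacter ℂ k)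
      refine ⟨∑ χ, m χ, Finset.sum_nonneg fun χ _ => hm0 χ, fun {_} χ hχ s hs => ?_⟩
      exact (hm χ hχ s hs).trans (Finset.single_le_sum (fun χ _ => hm0 χ) (Finset.mem_univ χ))
    · exact ⟨0, le_rfl, fun {h} => absurd h hk⟩
  choose m hm0 hm using h1
  refine ⟨∑ k ∈ Finset.range (K + 1), m k, Finset.sum_nonneg fun k _ => hm0 k, ?_⟩
  intro k _ χ hχ hk s hs1 hs2 hs3
  refine (hm k χ hχ s ?_).trans (Finset.single_le_sum (fun k _ => hm0 k)
    (Finset.mem_range.2 (by omega)))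
  exact ⟨⟨hs1, hs2⟩, abs_le.1 hs3⟩

lemma L_upper (c : ℝ) (hc : 0 < c) : ∃ A : ℝ, 1 ≤ A ∧ ∀ (T : ℝ), 3 ≤ T → ∀ (k : ℕ) [NeZero k]
    (χ : DirichletCharacter ℂ k), χ ≠ 1 → 1 ≤ Real.log (k * T) → ∀ s : ℂ,
    1 - 3 * c / Real.log (k * T) ≤ s.re → s.re ≤ 2 → |s.im| ≤ 2 * T →
    ‖DirichletCharacter.LFunction χ s‖ ≤ A * Real.log (k * T) := by
  obtain ⟨M, hM0, hM⟩ := L_compact ⌈Real.exp (6 * c)⌉₊ (1 - 3 * c) 2 (2 * Real.exp (6 * c))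
  have hE0 : 1 ≤ Real.exp (3 * c) := Real.one_le_exp (by positivity)
  refine ⟨34 * Real.exp (3 * c) + M, by linarith, ?_⟩
  intro T hT k _ χ hχ hL s h1 h2 h3
  have hk : (1:ℝ) ≤ k := by exact_mod_cast Nat.pos_of_ne_zero (NeZero.ne k)
  by_cases h : 1 / 2 ≤ s.re
  · refine (L_explicit hc hT χ hχ hL h1 h h2 h3).trans ?_
    gcongr; linarith
  · push Not at h
    have hLc : Real.log (k * T) ≤ 6 * c := by
      have : 1 / 2 ≤ 3 * c / Real.log (k * T) := by linarith
      rw [le_div_iff₀ (by linarith)] at this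
      linarith
    have hY : k * T ≤ Real.exp (6 * c) := (Real.log_le_iff_le_exp (by positivity)).1 hLc
    have hkY : (k:ℝ) ≤ Real.exp (6 * c) := by nlinarith
    have hTY : T ≤ Real.exp (6 * c) := by nlinarith
    have hdiv : 3 * c / Real.log (k * T) ≤ 3 * c := div_le_self (by positivity) hL
    have := hM k χ hχ (by exact_mod_cast hkY.trans (Nat.le_ceil _)) s (by linarith) h2
      (by linarith)
    nlinarith

theorem logL_bound_on_boundary (c : ℝ) (hc : 0 < c) :
    ∃ C : ℝ, 0 < C ∧ ∀ (T : ℝ), 3 ≤ T →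
      ∀ (k : ℕ) [NeZero k] (χ : DirichletCharacter ℂ k), χ ≠ 1 →
      (∀ s : ℂ, 1 - 3 * c / Real.log (k * T) ≤ s.re → |s.im| ≤ 2 * T →
        DirichletCharacter.LFunction χ s ≠ 0) →
      ∀ g : ℂ → ℂ,
        DifferentiableOn ℂ g {s : ℂ | 1 - 3 * c / Real.log (k * T) ≤ s.re ∧ |s.im| ≤ 2 * T} →
        (∀ s : ℂ, 1 - 3 * c / Real.log (k * T) ≤ s.re → |s.im| ≤ 2 * T →
          Complex.exp (g s) = DirichletCharacter.LFunction χ s) →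
        (∀ s : ℂ, 1 < s.re → g s = logLSeries χ s) →
        ∀ s : ℂ,
          ((s.re = 1 - c / Real.log (k * T) ∧ |s.im| ≤ T) ∨
            (1 - c / Real.log (k * T) ≤ s.re ∧ |s.im| = T)) →
          ‖g s‖ ≤ C * Real.log (Real.log (k * T)) := by
  obtain ⟨A, hA1, hA⟩ := L_upper c hc
  set n : ℕ := ⌈c⌉₊ + 2 with hn
  set l0 : ℝ := Real.log (3 / 2) with hl0
  have hl0pos : 0 < l0 := Real.log_pos (by norm_num)
  have hlA : 0 ≤ Real.log A := Real.log_nonneg hA1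
  have hlc : 0 ≤ Real.log (2 + 1 / c) := Real.log_nonneg (by
    have : 0 < 1 / c := by positivity
    linarith)
  refine ⟨3 ^ n * ((Real.log A / l0 + 1) + 2 * (Real.log (2 + 1 / c) / l0 + 1)), by positivity, ?_⟩
  intro T hT k _ χ hχ _ g hgd hgexp hgser s hs
  -- size of the parameters
  have hk2 : (2:ℝ) ≤ k := by
    have hk0 := NeZero.ne k
    have hk1 : k ≠ 1 := by
      rintro rfl
      exact hχ (DirichletCharacter.level_one _)
    exact_mod_cast (by omega : 2 ≤ k)
  set Y : ℝ := k * T with hY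
  have hY6 : 6 ≤ Y := by nlinarith
  set L := Real.log Y with hLdef
  have hL : 3 / 2 ≤ L := by
    rw [hLdef, Real.le_log_iff_exp_le (by linarith)]
    have h1 := Real.exp_one_lt_d9
    have h2 : Real.exp (3 / 2) ^ 2 = Real.exp 1 ^ 3 := by
      rw [← Real.exp_nat_mul, ← Real.exp_nat_mul]; norm_num
    have h3 : Real.exp 1 ^ 3 ≤ 6 ^ 2 := by
      calc Real.exp 1 ^ 3 ≤ (2.7182818286:ℝ) ^ 3 := by gcongr
        _ ≤ 6 ^ 2 := by norm_num
    have h4 : Real.exp (3 / 2) ≤ 6 := by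
      rw [← h2] at h3
      exact (pow_le_pow_iff_left₀ (Real.exp_pos _).le (by norm_num) (by norm_num)).1 h3
    linarith
  have hLpos : 0 < L := by linarith
  have hcL : 0 < c / L := by positivity
  have h3c : 3 * c / L = 3 * (c / L) := by ring
  set d : ℝ := min (c / L) 1 with hd
  have hd0 : 0 < d := lt_min hcL one_pos
  have hd1 : d ≤ 1 := min_le_right _ _
  have hdc : d ≤ c / L := min_le_left _ _
  set B := Real.log (1 + 1 / d) with hB
  have hBpos : 0 < B := Real.log_pos (by
    have : 0 < 1 / d := by positivity
    linarith)
  have hAL : 0 < Real.log (A * L) := Real.log_pos (by nlinarith)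
  set M := Real.log (A * L) + B with hM
  have hMpos : 0 < M := by positivity
  have hbase : ∀ w : ℂ, 1 + d ≤ w.re → ‖g w‖ ≤ B := by
    intro w hw
    rw [hgser w (by linarith)]
    exact logLSeries_norm_le χ hd0 hw
  have hre : ∀ w : ℂ, 1 - 3 * c / L ≤ w.re → |w.im| ≤ 2 * T → (g w).re ≤ M := by
    intro w hw1 hw2
    by_cases hw : 1 + d ≤ w.re
    · have := (Complex.re_le_norm (g w)).trans (hbase w hw)
      linarith
    · have h1 := hA T hT k χ hχ (by linarith) w hw1 (by linarith) hw2
      rw [← hgexp w hw1 hw2, Complex.norm_exp] at h1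
      have : (g w).re ≤ Real.log (A * L) := by
        rwa [Real.le_log_iff_exp_le (by positivity)]
      linarith
  have hind : ∀ m : ℕ, ∀ w : ℂ, 1 - c / L ≤ w.re → 1 + d - m * d ≤ w.re → |w.im| ≤ T →
      ‖g w‖ ≤ 3 ^ m * (B + M) - M := by
    intro m
    induction m with
    | zero =>
      intro w _ hw2 _
      have := hbase w (by simpa using hw2)
      simpa using this
    | succ m ih =>
      intro w hw1 hw2 hw3
      have hsub : Metric.ball (w + (d:ℂ)) (2 * d) ⊆
          {s : ℂ | 1 - 3 * c / L ≤ s.re ∧ |s.im| ≤ 2 * T} := by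
        intro z hz
        rw [Metric.mem_ball, dist_eq_norm] at hz
        have hzr := (Complex.abs_re_le_norm _).trans hz.le
        have hzi := (Complex.abs_im_le_norm _).trans hz.le
        simp only [Complex.sub_re, Complex.add_re, Complex.ofReal_re, Complex.sub_im,
          Complex.add_im, Complex.ofReal_im, add_zero] at hzr hzi
        rw [abs_le] at hzr hzi hw3
        refine ⟨by rw [h3c]; linarith, abs_le.2 ⟨by linarith, by linarith⟩⟩
      have hprev := ih (w + d) (by simp; linarith) (by
        push_cast at hw2
        simp only [Complex.add_re, Complex.ofReal_re]; linarith) (by simpa using hw3)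
      have := bc_step hMpos hd0 (hgd.mono hsub) (fun z hz => hre z (hsub hz).1 (hsub hz).2) hprev
      rw [pow_succ]; linarith
  have hs1 : 1 - c / L ≤ s.re := by rcases hs with h | h <;> linarith [h.1]
  have hs2 : |s.im| ≤ T := by rcases hs with h | h <;> linarith [h.2]
  have hnd : d + c / L ≤ n * d := by
    have hcc : c ≤ ⌈c⌉₊ := Nat.le_ceil c
    have hnn : (n:ℝ) = ⌈c⌉₊ + 2 := by rw [hn]; push_cast; ring
    rw [hnn]
    rcases min_choice (c / L) 1 with h | h
    · rw [← hd] at h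
      rw [← h]
      nlinarith
    · rw [← hd] at h
      have : c / L ≤ c := div_le_self hc.le (by linarith)
      rw [h]; linarith
  have hfin := hind n s hs1 (by linarith) hs2
  -- final comparison
  set l := Real.log L with hl
  have hl0l : l0 ≤ l := Real.log_le_log (by norm_num) hL
  have hAl : Real.log (A * L) ≤ (Real.log A / l0 + 1) * l := by
    rw [Real.log_mul (by positivity) hLpos.ne', ← hl]
    have : Real.log A ≤ Real.log A / l0 * l := by
      rw [div_mul_eq_mul_div, le_div_iff₀ hl0pos]; gcongr
    linarith
  have hBl : B ≤ (Real.log (2 + 1 / c) / l0 + 1) * l := by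
    have h1 : 1 + 1 / d ≤ (2 + 1 / c) * L := by
      have e : (2 + 1 / c) * L = 2 * L + L / c := by ring
      have : 0 < L / c := by positivity
      rw [e]
      rcases min_choice (c / L) 1 with h | h
      · rw [← hd] at h
        rw [h, one_div_div]; linarith
      · rw [← hd] at h
        rw [h]; linarith
    have h2 : B ≤ Real.log (2 + 1 / c) + l := by
      rw [hl, ← Real.log_mul (by positivity) hLpos.ne']
      exact Real.log_le_log (by positivity) h1
    have : Real.log (2 + 1 / c) ≤ Real.log (2 + 1 / c) / l0 * l := by
      rw [div_mul_eq_mul_div, le_div_iff₀ hl0pos]; gcongr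
    linarith
  calc ‖g s‖ ≤ 3 ^ n * (B + M) := by linarith
    _ = 3 ^ n * (Real.log (A * L) + 2 * B) := by rw [hM]; ring
    _ ≤ 3 ^ n * ((Real.log A / l0 + 1) * l + 2 * ((Real.log (2 + 1 / c) / l0 + 1) * l)) := by
        gcongr
    _ = _ := by ring
end

section
/- There exists a constant c₄ > 0 such that for every X ≥ 3 the following holds: there is at most one integer k with 3 ≤ k ≤ X admitting a real primitive Dirichlet character χ₁ modulo k such that L(s, χ₁) has a real zero β₁ with β₁ ≥ 1 − c₄/log X. That is, if k, k′ ∈ [3, X] both admit real primitive characters whose L-functions have a real zero ≥ 1 − c₄/log X, then k = k′. -/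
namespace LandauPage
open Complex Metric Set

/-- Zero-free case: Borel-Caratheodory for the logarithm, derivative version. -/
lemma base_strict {f : ℂ → ℂ} (hf : Differentiable ℂ f) {r A : ℝ} (hr : 0 < r) (hA : 0 < A)
    (h0 : ∀ z ∈ ball (0 : ℂ) r, f z ≠ 0)
    (hM : ∀ z ∈ ball (0 : ℂ) r, ‖f z‖ ≤ Real.exp A * ‖f 0‖) :
    ‖logDeriv f 0‖ ≤ 2 * A / r := by
  have h0m : (0 : ℂ) ∈ ball (0 : ℂ) r := mem_ball_self hr
  have hdl : DifferentiableOn ℂ (logDeriv f) (ball 0 r) := by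
    intro z hz
    have : DifferentiableAt ℂ (deriv f) z :=
      ((hf.differentiableOn (s := univ)).deriv isOpen_univ).differentiableAt Filter.univ_mem
    exact (this.div (hf z) (h0 z hz)).differentiableWithinAt
  obtain ⟨h, hh0, hh⟩ := hdl.isExactOn_ball.with_val_at 0 0
  -- f = f 0 * exp h
  have hexp : ∀ z ∈ ball (0 : ℂ) r, f z = f 0 * cexp (h z) := by
    intro z hz
    have hd : ∀ w ∈ ball (0 : ℂ) r, HasDerivAt (fun w => f w * cexp (-h w)) 0 w := by
      intro w hw
      have h1 := (hf w).hasDerivAt.mul ((hh w hw).neg.cexp)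
      refine h1.congr_deriv ?_
      have := h0 w hw
      simp only [logDeriv_apply]
      field_simp
      ring
    have hc := (convex_ball (0 : ℂ) r).is_const_of_fderivWithin_eq_zero (𝕜 := ℂ)
      (f := fun w => f w * cexp (-h w))
      (fun w hw => (hd w hw).differentiableAt.differentiableWithinAt)
      (fun w hw => by
        rw [fderivWithin_of_isOpen isOpen_ball hw]
        ext; simp [(hd w hw).deriv]) hz h0m
    simp only [hh0, neg_zero, Complex.exp_zero, mul_one] at hc
    rw [← hc, mul_assoc, ← Complex.exp_add]; simp
  have hre : ∀ z ∈ ball (0 : ℂ) r, (h z).re ≤ A := by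
    intro z hz
    have h1 := hM z hz
    rw [hexp z hz, norm_mul, Complex.norm_exp, mul_comm] at h1
    have := le_of_mul_le_mul_right h1 (norm_pos_iff.mpr (h0 0 h0m))
    exact Real.exp_le_exp.mp this
  have hden : ∀ z ∈ ball (0 : ℂ) r, (2 * A - h z : ℂ) ≠ 0 := by
    intro z hz hz0
    have := congrArg Complex.re hz0
    simp at this
    linarith [hre z hz]
  have hhd : ∀ z ∈ ball (0 : ℂ) r, DifferentiableAt ℂ h z := fun z hz => (hh z hz).differentiableAt
  have key := Complex.norm_deriv_le_div_of_mapsTo_ball (f := fun z => h z / (2 * A - h z)) (c := 0)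
    (R₁ := r) (R₂ := 1) (fun z hz => ((hhd z hz).div ((differentiableAt_const _).sub (hhd z hz))
      (hden z hz)).differentiableWithinAt) (by
      intro z hz
      simp only [hh0, zero_div, mem_closedBall, dist_zero_right, norm_div]
      apply div_le_one_of_le₀ _ (norm_nonneg _)
      rw [← sq_le_sq₀ (norm_nonneg _) (norm_nonneg _), Complex.sq_norm, Complex.sq_norm,
        Complex.normSq_apply, Complex.normSq_apply]
      have := hre z hz
      simp
      nlinarith) hr
  have hder : deriv (fun z => h z / (2 * A - h z)) 0 = logDeriv f 0 / (2 * A) := by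
    have h1 := (hh 0 h0m).div ((hasDerivAt_const (0 : ℂ) (2 * A : ℂ)).sub (hh 0 h0m)) (hden 0 h0m)
    have h2 := h1.deriv
    simp only [hh0] at h2
    have hA' : (A : ℂ) ≠ 0 := by exact_mod_cast hA.ne'
    refine h2.trans ?_
    simp [hh0]
    field_simp
  rw [hder, norm_div] at key
  simp only [norm_mul, Complex.norm_ofNat, Complex.norm_real, Real.norm_eq_abs, abs_of_pos hA] at key
  rw [div_le_iff₀ (by positivity)] at key
  calc _ ≤ _ := key
    _ = _ := by ring

lemma base {f : ℂ → ℂ} (hf : Differentiable ℂ f) {r M : ℝ} (hr : 0 < r)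
    (h0 : ∀ z ∈ ball (0 : ℂ) r, f z ≠ 0)
    (hM : ∀ z ∈ ball (0 : ℂ) r, ‖f z‖ ≤ M) :
    -(2 / r * Real.log (M / ‖f 0‖)) ≤ (logDeriv f 0).re := by
  have h0m : (0 : ℂ) ∈ ball (0 : ℂ) r := mem_ball_self hr
  have hp : 0 < ‖f 0‖ := norm_pos_iff.mpr (h0 0 h0m)
  have hMp : 0 < M := hp.trans_le (hM 0 h0m)
  have hl : 0 ≤ Real.log (M / ‖f 0‖) := Real.log_nonneg (by rw [le_div_iff₀ hp]; simpa using hM 0 h0m)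
  have : ‖logDeriv f 0‖ ≤ 2 / r * Real.log (M / ‖f 0‖) := by
    apply le_of_forall_pos_le_add
    intro ε hε
    have := base_strict hf hr (A := Real.log (M / ‖f 0‖) + ε * r / 2) (by positivity) h0 (by
      intro z hz
      rw [Real.exp_add, Real.exp_log (by positivity)]
      have h1 : 1 ≤ Real.exp (ε * r / 2) := Real.one_le_exp (by positivity)
      have h2 : M / ‖f 0‖ * Real.exp (ε * r / 2) * ‖f 0‖ = M * Real.exp (ε * r / 2) := by
        field_simp
      rw [h2]
      nlinarith [hM z hz])
    refine this.trans_eq ?_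
    field_simp
  linarith [neg_abs_le (logDeriv f 0).re, abs_re_le_norm (logDeriv f 0)]

/-- Dividing out a zero by a Blaschke factor. -/
lemma step {f : ℂ → ℂ} (hf : Differentiable ℂ f) {R M : ℝ} {ρ : ℂ} (hR : 0 < R)
    (hM : ∀ z ∈ closedBall (0 : ℂ) R, ‖f z‖ ≤ M)
    (hz : ∀ z ∈ closedBall (0 : ℂ) R, 0 ≤ z.re → f z ≠ 0)
    (hρ : f ρ = 0) (hρR : ‖ρ‖ < R) :
    ∃ g : ℂ → ℂ, Differentiable ℂ g ∧ (∀ z ∈ closedBall (0 : ℂ) R, ‖g z‖ ≤ M) ∧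
      (∀ z ∈ closedBall (0 : ℂ) R, 0 ≤ z.re → g z ≠ 0) ∧
      ‖g 0‖ = ‖f 0‖ * (R / ‖ρ‖) ∧ 0 < ‖ρ‖ ∧ ρ.re < 0 ∧
      (logDeriv f 0).re = (logDeriv g 0).re + (-ρ.re) * (1 / ‖ρ‖ ^ 2 - 1 / R ^ 2) := by
  have hρre : ρ.re < 0 := by
    by_contra h
    exact hz ρ (by simpa using hρR.le) (not_lt.mp h) hρ
  have hρ0 : ρ ≠ 0 := by rintro rfl; simp at hρre
  have hR' : (R : ℂ) ≠ 0 := by exact_mod_cast hR.ne'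
  have hds : Differentiable ℂ (dslope f ρ) := by
    rw [← differentiableOn_univ, Complex.differentiableOn_dslope Filter.univ_mem]
    exact hf.differentiableOn
  have hfd : ∀ z, f z = (z - ρ) * dslope f ρ z := by
    intro z
    have := sub_smul_dslope f ρ z
    simpa [hρ] using this.symm
  have hsm : ∀ z ∈ closedBall (0 : ℂ) R, ((R : ℂ) ^ 2 - (starRingEnd ℂ) ρ * z) ≠ 0 := by
    intro z hz h
    have h1 : (R : ℂ) ^ 2 = (starRingEnd ℂ) ρ * z := sub_eq_zero.mp h
    have h2 := congrArg norm h1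
    simp only [norm_pow, Complex.norm_real, norm_mul, Real.norm_eq_abs, abs_of_pos hR, RCLike.norm_conj] at h2
    have h3 : ‖z‖ ≤ R := by simpa using hz
    nlinarith [norm_nonneg z, norm_nonneg ρ]
  let g : ℂ → ℂ := fun z => (((R : ℂ) ^ 2 - (starRingEnd ℂ) ρ * z) / R) * dslope f ρ z
  have hlin : Differentiable ℂ (fun z : ℂ => ((R : ℂ) ^ 2 - (starRingEnd ℂ) ρ * z) / R) := by fun_prop
  have hg : Differentiable ℂ g := hlin.mul hds
  have h0m : (0 : ℂ) ∈ closedBall (0 : ℂ) R := mem_closedBall_self hR.le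
  have hf0 : f 0 ≠ 0 := hz 0 h0m (by simp)
  have hd0 : dslope f ρ 0 ≠ 0 := by
    intro h
    apply hf0; rw [hfd, h, mul_zero]
  have hnρ : 0 < ‖ρ‖ := norm_pos_iff.mpr hρ0
  refine ⟨g, hg, ?_, ?_, ?_, hnρ, hρre, ?_⟩
  · intro z hz
    refine Complex.norm_le_of_forall_mem_frontier_norm_le (U := ball (0 : ℂ) R) isBounded_ball
      hg.diffContOnCl ?_ ?_
    · intro w hw
      rw [frontier_ball _ hR.ne'] at hw
      have hw' : ‖w‖ = R := by simpa using hw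
      have : ‖g w‖ = ‖f w‖ := by
        rw [hfd w]
        simp only [g, norm_mul, norm_div, Complex.norm_real, Real.norm_eq_abs, abs_of_pos hR]
        congr 1
        have h1 : ((R : ℂ) ^ 2 - (starRingEnd ℂ) ρ * w) = w * (starRingEnd ℂ) (w - ρ) := by
          rw [map_sub, mul_sub, Complex.mul_conj, Complex.normSq_eq_norm_sq, hw']
          push_cast; ring
        rw [h1, norm_mul, hw', RCLike.norm_conj]
        field_simp
      rw [this]
      exact hM w (sphere_subset_closedBall hw)
    · rwa [closure_ball _ hR.ne']
  · intro z hzm hzre hgz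
    rcases mul_eq_zero.mp hgz with h | h
    · exact (div_ne_zero (hsm z hzm) hR') h
    · exact hz z hzm hzre (by rw [hfd, h, mul_zero])
  · rw [hfd 0]
    simp only [g, norm_mul, norm_div, Complex.norm_real, Real.norm_eq_abs, abs_of_pos hR]
    simp
    field_simp
  · have e1 : logDeriv f 0 = -1 / ρ + logDeriv (dslope f ρ) 0 := by
      have : f = fun z => (z - ρ) * dslope f ρ z := funext hfd
      conv_lhs => rw [this]
      rw [logDeriv_mul (f := fun z => z - ρ) 0 (by simpa using hρ0) hd0 (by fun_prop) (hds 0)]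
      congr 1
      simp [logDeriv_apply]
      field_simp
    have e2 : logDeriv g 0 = -(starRingEnd ℂ) ρ / R ^ 2 + logDeriv (dslope f ρ) 0 := by
      rw [logDeriv_mul (f := fun z => ((R : ℂ) ^ 2 - (starRingEnd ℂ) ρ * z) / R) 0
        (div_ne_zero (hsm 0 h0m) hR') hd0 (hlin 0) (hds 0)]
      congr 1
      simp [logDeriv_apply]
      have : deriv (fun z : ℂ => (R : ℂ) ^ 2 - (starRingEnd ℂ) ρ * z) 0 = -(starRingEnd ℂ) ρ := by
        rw [deriv_const_sub]; simp
      field_simp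
    rw [e1, e2]
    have r1 : (-1 / ρ).re = -ρ.re / ‖ρ‖ ^ 2 := by
      rw [Complex.div_re, Complex.normSq_eq_norm_sq]; simp
    have r2 : (-(starRingEnd ℂ) ρ / R ^ 2 : ℂ).re = - ρ.re / R ^ 2 := by
      rw [← Complex.ofReal_pow, Complex.div_ofReal_re]; simp
    rw [Complex.add_re, Complex.add_re, r1, r2]
    ring

lemma mainA_aux {r R M : ℝ} (hr : 0 < r) (hrR : r < R) (N : ℕ) :
    ∀ {f : ℂ → ℂ} (_ : Differentiable ℂ f)
    (_ : ∀ z ∈ closedBall (0 : ℂ) R, ‖f z‖ ≤ M)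
    (_ : ∀ z ∈ closedBall (0 : ℂ) R, 0 ≤ z.re → f z ≠ 0)
    (_ : M * (r / R) ^ N ≤ ‖f 0‖),
    -(2 / r * Real.log (M / ‖f 0‖)) ≤ (logDeriv f 0).re := by
  have hR : 0 < R := hr.trans hrR
  induction N with
  | zero =>
    intro f hf hM hz hN
    by_cases hzero : ∃ ρ ∈ ball (0 : ℂ) r, f ρ = 0
    · exfalso
      obtain ⟨ρ, hρ, hfρ⟩ := hzero
      have hρr : ‖ρ‖ < r := by simpa using hρ
      obtain ⟨g, -, hgM, -, hg0, hρ0, -, -⟩ := step hf hR hM hz hfρ (hρr.trans hrR)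
      have h1 := hgM 0 (mem_closedBall_self hR.le)
      have h2 : 0 < ‖f 0‖ := norm_pos_iff.mpr (hz 0 (mem_closedBall_self hR.le) (by simp))
      have h3 : 1 < R / ‖ρ‖ := by rw [one_lt_div hρ0]; linarith
      rw [hg0] at h1
      simp at hN
      nlinarith
    · push Not at hzero
      exact base hf hr hzero fun z hz => hM z (ball_subset_closedBall (ball_subset_ball hrR.le hz))
  | succ N ih =>
    intro f hf hM hz hN
    have h2 : 0 < ‖f 0‖ := norm_pos_iff.mpr (hz 0 (mem_closedBall_self hR.le) (by simp))
    by_cases hzero : ∃ ρ ∈ ball (0 : ℂ) r, f ρ = 0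
    · obtain ⟨ρ, hρ, hfρ⟩ := hzero
      have hρr : ‖ρ‖ < r := by simpa using hρ
      obtain ⟨g, hg, hgM, hgz, hg0, hρ0, hρre, hl⟩ := step hf hR hM hz hfρ (hρr.trans hrR)
      have hge : ‖f 0‖ * (R / r) ≤ ‖g 0‖ := by rw [hg0]; gcongr
      have h3 := ih hg hgM hgz (by
        refine le_trans ?_ hge
        calc M * (r / R) ^ N = M * (r / R) ^ (N + 1) * (R / r) := by
              rw [pow_succ]; field_simp
          _ ≤ _ := by gcongr)
      have hfg : ‖f 0‖ ≤ ‖g 0‖ := by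
        refine le_trans ?_ hge
        have : 1 ≤ R / r := by rw [one_le_div hr]; exact hrR.le
        nlinarith
      have hMp : 0 < M := h2.trans_le (hM 0 (mem_closedBall_self hR.le))
      have h4 : Real.log (M / ‖g 0‖) ≤ Real.log (M / ‖f 0‖) := by
        apply Real.log_le_log (div_pos hMp (h2.trans_le hfg))
        gcongr
      have h5 : 0 ≤ (-ρ.re) * (1 / ‖ρ‖ ^ 2 - 1 / R ^ 2) := by
        apply mul_nonneg (by linarith)
        rw [sub_nonneg]
        gcongr
        exact (hρr.trans hrR).le
      have h6 : 2 / r * Real.log (M / ‖g 0‖) ≤ 2 / r * Real.log (M / ‖f 0‖) := by gcongr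
      linarith
    · push Not at hzero
      exact base hf hr hzero fun z hz => hM z (ball_subset_closedBall (ball_subset_ball hrR.le hz))

lemma mainA {r R M : ℝ} (hr : 0 < r) (hrR : r < R) {f : ℂ → ℂ} (hf : Differentiable ℂ f)
    (hM : ∀ z ∈ closedBall (0 : ℂ) R, ‖f z‖ ≤ M)
    (hz : ∀ z ∈ closedBall (0 : ℂ) R, 0 ≤ z.re → f z ≠ 0) :
    -(2 / r * Real.log (M / ‖f 0‖)) ≤ (logDeriv f 0).re := by
  have hR : 0 < R := hr.trans hrR
  have h2 : 0 < ‖f 0‖ := norm_pos_iff.mpr (hz 0 (mem_closedBall_self hR.le) (by simp))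
  have hMp : 0 < M := h2.trans_le (hM 0 (mem_closedBall_self hR.le))
  obtain ⟨N, hN⟩ := exists_pow_lt_of_lt_one (div_pos h2 hMp) ((div_lt_one hR).mpr hrR)
  refine mainA_aux hr hrR N hf hM hz ?_
  rw [lt_div_iff₀ hMp] at hN
  linarith

lemma mainB {r R M d : ℝ} (hr : 0 < r) (hrR : r < R) {f : ℂ → ℂ} (hf : Differentiable ℂ f)
    (hM : ∀ z ∈ closedBall (0 : ℂ) R, ‖f z‖ ≤ M)
    (hz : ∀ z ∈ closedBall (0 : ℂ) R, 0 ≤ z.re → f z ≠ 0) (hd : 0 < d) (hdR : d < R)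
    (hfd : f (-d : ℝ) = 0) :
    1 / d - d / R ^ 2 - (2 / r * Real.log (M / ‖f 0‖)) ≤ (logDeriv f 0).re := by
  have hR : 0 < R := hr.trans hrR
  have h2 : 0 < ‖f 0‖ := norm_pos_iff.mpr (hz 0 (mem_closedBall_self hR.le) (by simp))
  have hMp : 0 < M := h2.trans_le (hM 0 (mem_closedBall_self hR.le))
  have hnd : ‖((-d : ℝ) : ℂ)‖ = d := by simp [abs_of_pos hd]
  obtain ⟨g, hg, hgM, hgz, hg0, hρ0, hρre, hl⟩ := step hf hR hM hz hfd (by rwa [hnd])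
  have h3 := mainA hr hrR hg hgM hgz
  rw [hnd] at hl hg0
  have hfg : ‖f 0‖ ≤ ‖g 0‖ := by
    have : 1 ≤ R / d := by rw [one_le_div hd]; exact hdR.le
    rw [hg0]; nlinarith
  have h4 : Real.log (M / ‖g 0‖) ≤ Real.log (M / ‖f 0‖) := by
    apply Real.log_le_log (div_pos hMp (h2.trans_le hfg))
    gcongr
  have h6 : 2 / r * Real.log (M / ‖g 0‖) ≤ 2 / r * Real.log (M / ‖f 0‖) := by gcongr
  have h7 : (-((-d : ℝ) : ℂ).re) * (1 / d ^ 2 - 1 / R ^ 2) = 1 / d - d / R ^ 2 := by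
    simp only [Complex.ofReal_re]
    field_simp
  linarith

end LandauPage

namespace LandauPage
open Complex Metric Set

lemma charSum_zero {q : ℕ} [NeZero q] {χ : DirichletCharacter ℂ q} (hχ : χ ≠ 1) (a : ZMod q) :
    ∑ k ∈ Finset.range q, χ (a + k) = 0 := by
  have h := MulChar.sum_eq_zero_of_ne_one hχ
  rw [← Equiv.sum_comp (Equiv.addLeft a)] at h
  rw [← h]
  symm
  refine Finset.sum_bij' (fun x _ => x.val) (fun k _ => (k : ZMod q)) ?_ ?_ ?_ ?_ ?_
  · intro x _; simpa using ZMod.val_lt x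
  · simp
  · simp
  · intro k hk; exact ZMod.val_cast_of_lt (by simpa using hk)
  · simp

lemma charSum_bound {q : ℕ} [NeZero q] {χ : DirichletCharacter ℂ q} (hχ : χ ≠ 1) (n : ℕ) :
    ‖∑ k ∈ Finset.Icc 1 n, χ (k : ZMod q)‖ ≤ q := by
  have h0 : ∑ k ∈ Finset.Icc 1 n, χ (k : ZMod q) = ∑ k ∈ Finset.range n, χ (1 + (k : ℕ) : ZMod q) := by
    induction n with
    | zero => simp
    | succ n ih => rw [Finset.sum_Icc_succ_top (by omega), Finset.sum_range_succ, ih]; simp [add_comm]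
  rw [h0]
  clear h0
  induction n using Nat.strong_induction_on with
  | _ n ih =>
    by_cases hn : n < q
    · refine (norm_sum_le _ _).trans ?_
      refine (Finset.sum_le_card_nsmul _ _ 1 fun k _ => χ.norm_le_one _).trans ?_
      simpa using hn.le
    · obtain ⟨m, rfl⟩ := Nat.exists_eq_add_of_le' (not_lt.mp hn)
      have hq : 0 < q := Nat.pos_of_ne_zero (NeZero.ne q)
      rw [Finset.sum_range_add]
      have := charSum_zero hχ (1 + (m : ZMod q))
      push_cast
      simp_rw [← add_assoc]
      rw [this, add_zero]
      exact ih m (by omega)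

lemma LFunction_bound {q : ℕ} [NeZero q] {χ : DirichletCharacter ℂ q} (hχ : χ ≠ 1) {s : ℂ}
    (hs : 0 < s.re) : ‖DirichletCharacter.LFunction χ s‖ ≤ ‖s‖ * (q / s.re) := by
  let S : ℝ → ℂ := fun t => ∑ k ∈ Finset.Icc 1 ⌊t⌋₊, χ (k : ZMod q)
  have hSb : ∀ t, ‖S t‖ ≤ q := fun t => charSum_bound hχ _
  have hSloc : MeasureTheory.LocallyIntegrableOn S (Ici 0) := by
    have := locallyIntegrableOn_mul_sum_Icc (𝕜 := ℂ) (fun k : ℕ => χ (k : ZMod q)) (m := 1) (a := 0) le_rfl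
      (g := fun _ => 1) ((MeasureTheory.locallyIntegrable_const _).locallyIntegrableOn _)
    simpa [S] using this
  have hS1 : ∀ t < 1, S t = 0 := by
    intro t ht
    have : ⌊t⌋₊ = 0 := Nat.floor_eq_zero.mpr ht
    simp [S, this]
  have hdiff : ∀ z : ℂ, 0 < z.re → DifferentiableAt ℂ (fun z => z * mellin S (-z)) z := by
    intro z hz
    have h1 : DifferentiableAt ℂ (mellin S) (-z) := by
      refine mellin_differentiableAt_of_isBigO_rpow (a := 0) (b := -z.re - 1)
        (hSloc.mono_set Ioi_subset_Ici_self) ?_ (by simpa) ?_ (by simp)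
      · refine Asymptotics.IsBigO.of_bound q (Filter.Eventually.of_forall fun t => ?_)
        simpa using hSb t
      · refine Asymptotics.IsBigO.of_bound 0 ?_
        filter_upwards [mem_nhdsWithin_of_mem_nhds (Iio_mem_nhds (zero_lt_one (α := ℝ)))] with t ht
        simp [hS1 t ht]
    exact differentiableAt_id.mul (h1.comp z differentiableAt_id.neg)
  have hmel : ∀ z : ℂ, mellin S (-z) = ∫ t in Ioi (1 : ℝ), S t * t ^ (-(z + 1)) := by
    intro z
    rw [mellin]
    have hsub : Ici (1 : ℝ) ⊆ Ioi 0 := fun t ht => mem_Ioi.mpr (lt_of_lt_of_le zero_lt_one (mem_Ici.mp ht))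
    rw [MeasureTheory.setIntegral_eq_of_subset_of_forall_sdiff_eq_zero measurableSet_Ioi hsub,
      MeasureTheory.integral_Ici_eq_integral_Ioi]
    · refine MeasureTheory.setIntegral_congr_fun measurableSet_Ioi fun t ht => ?_
      simp only [smul_eq_mul]
      rw [mul_comm]; congr 2; ring
    · intro t ht
      rw [hS1 t (by simpa using ht.2), smul_zero]
  have hEq : EqOn (DirichletCharacter.LFunction χ) (fun z => z * mellin S (-z)) {z | 0 < z.re} := by
    have ho : IsOpen {z : ℂ | 0 < z.re} := isOpen_lt continuous_const continuous_re
    refine AnalyticOnNhd.eqOn_of_preconnected_of_eventuallyEq (𝕜 := ℂ) (z₀ := 2)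
      ((DirichletCharacter.differentiable_LFunction hχ).differentiableOn.analyticOnNhd ho)
      (DifferentiableOn.analyticOnNhd (fun z hz => (hdiff z hz).differentiableWithinAt) ho)
      (convex_halfSpace_re_gt 0).isPreconnected (by simp) ?_
    have ho1 : {z : ℂ | 1 < z.re} ∈ nhds (2 : ℂ) :=
      (isOpen_lt continuous_const continuous_re).mem_nhds (by simp)
    filter_upwards [ho1] with z hz
    have hz' : 1 < z.re := hz
    rw [DirichletCharacter.LFunction_eq_LSeries χ hz', hmel]
    refine LSeries_eq_mul_integral _ (r := 0) le_rfl (by linarith)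
      (DirichletCharacter.LSeriesSummable_of_one_lt_re χ hz') ?_
    refine Asymptotics.IsBigO.of_bound q (Filter.Eventually.of_forall fun n => ?_)
    simpa using charSum_bound hχ n
  rw [hEq hs]
  simp only [norm_mul]
  gcongr
  rw [hmel]
  have hint := integrableOn_Ioi_rpow_of_lt (a := -(s.re + 1)) (by linarith) (zero_lt_one)
  calc _ ≤ ∫ t in Ioi (1 : ℝ), q * t ^ (-(s.re + 1)) := by
        refine MeasureTheory.norm_integral_le_of_norm_le (hint.const_mul _) ?_
        refine (MeasureTheory.ae_restrict_iff' measurableSet_Ioi).mpr (Filter.Eventually.of_forall fun t ht => ?_)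
        have ht0 : (0 : ℝ) < t := lt_trans zero_lt_one ht
        rw [norm_mul, Complex.norm_cpow_eq_rpow_re_of_pos ht0]
        simp only [neg_re, add_re, one_re]
        gcongr
        exact hSb t
    _ = _ := by
        rw [MeasureTheory.integral_const_mul, integral_Ioi_rpow_of_lt (by linarith) zero_lt_one]
        simp
        field_simp

end LandauPage

namespace LandauPage
open Complex Metric Set

lemma real_vals {q : ℕ} [NeZero q] {χ : DirichletCharacter ℂ q} (h : ∀ n : ZMod q, (χ n).im = 0)
    (a : ZMod q) : χ a = 0 ∨ χ a = 1 ∨ χ a = -1 := by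
  by_cases ha : IsUnit a
  · right
    obtain ⟨u, rfl⟩ := ha
    have h1 := DirichletCharacter.unit_norm_eq_one χ u
    have h2 : χ u = ((χ u).re : ℂ) := by
      apply Complex.ext <;> simp [h]
    rw [h2, Complex.norm_real, Real.norm_eq_abs] at h1
    rw [h2]
    rcases (abs_eq zero_le_one).mp h1 with h3 | h3 <;> simp [h3]
  · left; exact MulChar.map_nonunit χ ha

/-- the product character at level `k * k'` -/
noncomputable def prodChar {k k' : ℕ} (χ : DirichletCharacter ℂ k) (χ' : DirichletCharacter ℂ k') :
    DirichletCharacter ℂ (k * k') :=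
  DirichletCharacter.changeLevel (k.dvd_mul_right k') χ *
    DirichletCharacter.changeLevel (k'.dvd_mul_left k) χ'

lemma prodChar_apply {k k' : ℕ} [NeZero k] [NeZero k'] (χ : DirichletCharacter ℂ k)
    (χ' : DirichletCharacter ℂ k') (n : ℕ) :
    prodChar χ χ' (n : ZMod (k * k')) = χ (n : ZMod k) * χ' (n : ZMod k') := by
  by_cases hn : IsUnit (n : ZMod (k * k'))
  · have hc : n.Coprime (k * k') := (ZMod.isUnit_iff_coprime _ _).mp hn
    have hc' : IsCoprime (n : ℤ) ((k * k' : ℕ) : ℤ) := Nat.isCoprime_iff_coprime.mpr hc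
    have h1 := DirichletCharacter.changeLevel_eq_cast_of_dvd' χ (k.dvd_mul_right k') hc'
    have h2 := DirichletCharacter.changeLevel_eq_cast_of_dvd' χ' (k'.dvd_mul_left k) hc'
    simp only [Int.cast_natCast] at h1 h2
    rw [prodChar, MulChar.mul_apply, h1, h2]
  · rw [MulChar.map_nonunit _ hn]
    rw [ZMod.isUnit_iff_coprime, Nat.coprime_mul_iff_right, not_and_or] at hn
    rcases hn with h | h
    · rw [MulChar.map_nonunit χ (by rwa [ZMod.isUnit_iff_coprime]), zero_mul]
    · rw [MulChar.map_nonunit χ' (by rwa [ZMod.isUnit_iff_coprime]), mul_zero]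

lemma prodChar_ne_one {k k' : ℕ} [NeZero k] [NeZero k'] {χ : DirichletCharacter ℂ k}
    {χ' : DirichletCharacter ℂ k'} (hp : χ.IsPrimitive) (hp' : χ'.IsPrimitive) (hne : k ≠ k') :
    prodChar χ χ' ≠ 1 := by
  intro h
  have h1 := eq_inv_of_mul_eq_one_left h
  have h2 := congrArg DirichletCharacter.conductor h1
  rw [DirichletCharacter.conductor_inv, DirichletCharacter.conductor_changeLevel,
    DirichletCharacter.conductor_changeLevel] at h2
  exact hne (hp.symm.trans (h2.trans hp'))

lemma one_le_norm_prod {k k' : ℕ} [NeZero k] [NeZero k'] {χ : DirichletCharacter ℂ k}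
    {χ' : DirichletCharacter ℂ k'} (h : ∀ n : ZMod k, (χ n).im = 0)
    (h' : ∀ n : ZMod k', (χ' n).im = 0) {σ : ℝ} (hσ : 1 < σ) :
    1 ≤ ‖DirichletCharacter.LFunction (1 : DirichletCharacter ℂ 1) σ‖ *
      ‖DirichletCharacter.LFunction χ σ‖ * ‖DirichletCharacter.LFunction χ' σ‖ *
      ‖DirichletCharacter.LFunction (prodChar χ χ') σ‖ := by
  have hs : 1 < (σ : ℂ).re := by simpa
  simp_rw [DirichletCharacter.LFunction_eq_LSeries _ hs, ← norm_mul]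
  have H := (((DirichletCharacter.LSeries_eulerProduct_hasProd (1 : DirichletCharacter ℂ 1) hs).mul
    (DirichletCharacter.LSeries_eulerProduct_hasProd χ hs)).mul
    (DirichletCharacter.LSeries_eulerProduct_hasProd χ' hs)).mul
    (DirichletCharacter.LSeries_eulerProduct_hasProd (prodChar χ χ') hs)
  refine ge_of_tendsto H.norm (Filter.Eventually.of_forall fun S => ?_)
  refine Finset.prod_induction _ (fun t : ℝ => 1 ≤ t) (fun a b ha hb => one_le_mul_of_one_le_of_one_le ha hb) le_rfl fun p _ => ?_
  have hp0 : (0 : ℝ) < (p : ℕ) := by exact_mod_cast p.2.pos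
  obtain ⟨x, hx⟩ : ∃ x : ℝ, x = ((p : ℕ) : ℝ) ^ (-σ) := ⟨_, rfl⟩
  have hxp : 0 < x := by rw [hx]; positivity
  have hx1 : x < 1 := by
    rw [hx]; exact Real.rpow_lt_one_of_one_lt_of_neg (by exact_mod_cast p.2.one_lt) (by linarith)
  have hcx : ((p : ℕ) : ℂ) ^ (-(σ : ℂ)) = (x : ℂ) := by
    rw [hx, Complex.ofReal_cpow hp0.le]; simp
  have h1 : (1 : DirichletCharacter ℂ 1) ((p : ℕ) : ZMod 1) = 1 :=
    MulChar.one_apply (isUnit_of_subsingleton _)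
  rw [hcx, prodChar_apply, h1, ← mul_inv, ← mul_inv, ← mul_inv, norm_inv]
  obtain ⟨e, he, he'⟩ : ∃ e : ℝ, χ ((p : ℕ) : ZMod k) = e ∧ (e = 0 ∨ e = 1 ∨ e = -1) := by
    rcases real_vals h ((p : ℕ) : ZMod k) with h | h | h
    · exact ⟨0, by simp [h], by simp⟩
    · exact ⟨1, by simp [h], by simp⟩
    · exact ⟨-1, by simp [h], by simp⟩
  obtain ⟨e2, he2, he2'⟩ : ∃ e : ℝ, χ' ((p : ℕ) : ZMod k') = e ∧ (e = 0 ∨ e = 1 ∨ e = -1) := by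
    rcases real_vals h' ((p : ℕ) : ZMod k') with h | h | h
    · exact ⟨0, by simp [h], by simp⟩
    · exact ⟨1, by simp [h], by simp⟩
    · exact ⟨-1, by simp [h], by simp⟩
  rw [he, he2]
  have hcast : ((1 - 1 * (x : ℂ)) * (1 - e * x) * (1 - e2 * x) * (1 - e * e2 * x)) =
      (((1 - x) * (1 - e * x) * (1 - e2 * x) * (1 - e * e2 * x) : ℝ) : ℂ) := by push_cast; ring
  rw [hcast, Complex.norm_real, Real.norm_eq_abs]
  have hy : 0 < 1 - x := by linarith
  have hx2 : x * x < 1 := by nlinarith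
  have key : 0 < (1 - x) * (1 - e * x) * (1 - e2 * x) * (1 - e * e2 * x) ∧
      (1 - x) * (1 - e * x) * (1 - e2 * x) * (1 - e * e2 * x) ≤ 1 := by
    have a1 : (1 - x) * (1 - x) ≤ 1 := by nlinarith
    have a2 : (1 - x) * (1 + x) ≤ 1 := by nlinarith
    have b1 : 0 < (1 - x) * (1 - x) := by positivity
    have b2 : 0 < (1 - x) * (1 + x) := by positivity
    have c1 : ((1 - x) * (1 - x)) * ((1 - x) * (1 - x)) ≤ 1 := by nlinarith
    have c2 : ((1 - x) * (1 + x)) * ((1 - x) * (1 + x)) ≤ 1 := by nlinarith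
    have d1 : 0 < ((1 - x) * (1 - x)) * ((1 - x) * (1 - x)) := by positivity
    have d2 : 0 < ((1 - x) * (1 + x)) * ((1 - x) * (1 + x)) := by positivity
    rcases he' with rfl | rfl | rfl <;> rcases he2' with rfl | rfl | rfl <;>
      constructor <;> ring_nf at * <;> linarith
  rw [abs_of_pos key.1]
  exact (one_le_inv₀ key.1).mpr key.2

lemma logDeriv_LFunction {k : ℕ} [NeZero k] (χ : DirichletCharacter ℂ k) {s : ℂ} (hs : 1 < s.re) :
    HasSum (fun n => LSeries.term ((fun n : ℕ => χ (n : ZMod k)) *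
      (fun n => (ArithmeticFunction.vonMangoldt n : ℂ))) s n)
      (-logDeriv (DirichletCharacter.LFunction χ) s) := by
  have h1 := DirichletCharacter.LSeries_twist_vonMangoldt_eq χ hs
  have h2 := (DirichletCharacter.LSeriesSummable_twist_vonMangoldt χ hs).hasSum
  rw [logDeriv_apply, DirichletCharacter.deriv_LFunction_eq_deriv_LSeries χ hs,
    DirichletCharacter.LFunction_eq_LSeries χ hs, ← neg_div, ← h1]
  exact h2

lemma logDeriv_sum_nonpos {k k' : ℕ} [NeZero k] [NeZero k'] {χ : DirichletCharacter ℂ k}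
    {χ' : DirichletCharacter ℂ k'} (h : ∀ n : ZMod k, (χ n).im = 0)
    (h' : ∀ n : ZMod k', (χ' n).im = 0) {σ : ℝ} (hσ : 1 < σ) :
    (logDeriv (DirichletCharacter.LFunction (1 : DirichletCharacter ℂ 1)) σ).re +
      (logDeriv (DirichletCharacter.LFunction χ) σ).re +
      (logDeriv (DirichletCharacter.LFunction χ') σ).re +
      (logDeriv (DirichletCharacter.LFunction (prodChar χ χ')) σ).re ≤ 0 := by
  have hs : 1 < (σ : ℂ).re := by simpa
  have H := Complex.hasSum_re ((((logDeriv_LFunction (1 : DirichletCharacter ℂ 1) hs).add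
    (logDeriv_LFunction χ hs)).add
    (logDeriv_LFunction χ' hs)).add
    (logDeriv_LFunction (prodChar χ χ') hs))
  have := H.nonneg (fun n => ?_)
  · simp only [add_re, neg_re] at this
    linarith
  rcases eq_or_ne n 0 with rfl | hn
  · simp
  simp only [LSeries.term_of_ne_zero hn, Pi.mul_apply]
  rw [prodChar_apply, ← add_div, ← add_div, ← add_div]
  have h1 : (1 : DirichletCharacter ℂ 1) (n : ZMod 1) = 1 :=
    MulChar.one_apply (isUnit_of_subsingleton _)
  have hcx : (n : ℂ) ^ (σ : ℂ) = (((n : ℝ) ^ σ : ℝ) : ℂ) := by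
    rw [Complex.ofReal_cpow n.cast_nonneg]; simp
  rw [hcx, Complex.div_ofReal_re, h1]
  apply div_nonneg _ (by positivity)
  have hL : 0 ≤ ArithmeticFunction.vonMangoldt n := ArithmeticFunction.vonMangoldt_nonneg
  rcases real_vals h (n : ZMod k) with h | h | h <;>
    rcases real_vals h' (n : ZMod k') with h' | h' | h' <;> rw [h, h'] <;> simp <;> linarith

end LandauPage

namespace LandauPage
open Complex Metric Set

lemma logDeriv_translate (F : ℂ → ℂ) (c : ℂ) : logDeriv (fun z => F (c + z)) 0 = logDeriv F c := by
  simp only [logDeriv_apply]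
  rw [deriv_comp_const_add]; simp

lemma L_ball_bound {q : ℕ} [NeZero q] {χ : DirichletCharacter ℂ q} (hχ : χ ≠ 1) {σ : ℝ}
    (h1 : 1 < σ) (h2 : σ ≤ 3 / 2) {z : ℂ} (hz : z ∈ closedBall (0 : ℂ) (1 / 2)) :
    ‖DirichletCharacter.LFunction χ (σ + z)‖ ≤ 4 * q := by
  have hz' : ‖z‖ ≤ 1 / 2 := by simpa using hz
  have hre : 1 / 2 ≤ ((σ : ℂ) + z).re := by
    have := (abs_le.mp ((abs_re_le_norm z).trans hz')).1
    simp; linarith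
  have hn : ‖(σ : ℂ) + z‖ ≤ 2 := by
    refine (norm_add_le _ _).trans ?_
    rw [Complex.norm_real, Real.norm_eq_abs, abs_of_pos (by linarith)]
    linarith
  refine (LFunction_bound hχ (by linarith)).trans ?_
  calc _ ≤ 2 * (q / (1 / 2 : ℝ)) := by gcongr
    _ = _ := by ring

lemma L_A {q : ℕ} [NeZero q] {χ : DirichletCharacter ℂ q} (hχ : χ ≠ 1) {σ : ℝ}
    (h1 : 1 < σ) (h2 : σ ≤ 3 / 2) :
    -(8 * Real.log (4 * q / ‖DirichletCharacter.LFunction χ σ‖)) ≤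
      (logDeriv (DirichletCharacter.LFunction χ) σ).re := by
  have hd : Differentiable ℂ (fun z => DirichletCharacter.LFunction χ (σ + z)) :=
    (DirichletCharacter.differentiable_LFunction hχ).comp (by fun_prop)
  have := mainA (r := 1 / 4) (R := 1 / 2) (by norm_num) (by norm_num) hd
    (fun z hz => L_ball_bound hχ h1 h2 hz)
    (fun z _ hz => DirichletCharacter.LFunction_ne_zero_of_one_le_re χ (.inl hχ) (by simp; linarith))
  rw [logDeriv_translate] at this
  norm_num at this ⊢
  linarith

lemma L_B {q : ℕ} [NeZero q] {χ : DirichletCharacter ℂ q} (hχ : χ ≠ 1) {σ β : ℝ}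
    (h1 : 1 < σ) (h2 : σ ≤ 3 / 2) (hβ : DirichletCharacter.LFunction χ β = 0) (hd2 : σ - β < 1 / 2) :
    0 < σ - β ∧ 1 / (σ - β) - 4 * (σ - β) - 8 * Real.log (4 * q / ‖DirichletCharacter.LFunction χ σ‖) ≤
      (logDeriv (DirichletCharacter.LFunction χ) σ).re := by
  have hβ1 : β < 1 := by
    by_contra h
    exact DirichletCharacter.LFunction_ne_zero_of_one_le_re χ (.inl hχ) (s := β) (by simpa using h) hβ
  have hd : Differentiable ℂ (fun z => DirichletCharacter.LFunction χ (σ + z)) :=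
    (DirichletCharacter.differentiable_LFunction hχ).comp (by fun_prop)
  have := mainB (r := 1 / 4) (R := 1 / 2) (d := σ - β) (by norm_num) (by norm_num) hd
    (fun z hz => L_ball_bound hχ h1 h2 hz)
    (fun z _ hz => DirichletCharacter.LFunction_ne_zero_of_one_le_re χ (.inl hχ) (by simp; linarith))
    (by linarith) hd2 (by
      have : (σ : ℂ) + ((-(σ - β) : ℝ) : ℂ) = β := by push_cast; ring
      rw [this, hβ])
  refine ⟨by linarith, ?_⟩
  rw [logDeriv_translate] at this
  norm_num at this ⊢
  linarith

lemma Z_A : ∃ M : ℝ, 1 ≤ M ∧ ∀ η : ℝ, 0 < η → η ≤ 1 / 2 →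
    -(8 * Real.log (M / (η * ‖DirichletCharacter.LFunction (1 : DirichletCharacter ℂ 1) (1 + η : ℝ)‖))) ≤
      1 / η + (logDeriv (DirichletCharacter.LFunction (1 : DirichletCharacter ℂ 1)) (1 + η : ℝ)).re := by
  have hD := DirichletCharacter.differentiable_LFunctionTrivChar₁ 1
  obtain ⟨M, hM⟩ := (isCompact_closedBall (0 : ℂ) 2).exists_bound_of_continuousOn
    hD.continuous.continuousOn
  refine ⟨max M 1, le_max_right _ _, fun η h1 h2 => ?_⟩
  have hd : Differentiable ℂ (fun z => DirichletCharacter.LFunctionTrivChar₁ 1 ((1 + η : ℝ) + z)) :=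
    hD.comp (by fun_prop)
  have hne : ∀ s : ℂ, 1 < s.re → s ≠ 1 := by rintro s h rfl; simp at h
  have hval : ∀ s : ℂ, 1 < s.re → DirichletCharacter.LFunctionTrivChar₁ 1 s =
      (s - 1) * DirichletCharacter.LFunction (1 : DirichletCharacter ℂ 1) s := by
    intro s hs
    rw [DirichletCharacter.LFunctionTrivChar₁, Function.update_of_ne (hne s hs)]
  have hσ : 1 < ((1 + η : ℝ) : ℂ).re := by simpa
  have := mainA (r := 1 / 4) (R := 1 / 2) (M := max M 1) (by norm_num) (by norm_num) hd
    (fun z hz => (hM _ (by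
      have hz' : ‖z‖ ≤ 1 / 2 := by simpa using hz
      rw [mem_closedBall, dist_zero_right]
      refine (norm_add_le _ _).trans ?_
      rw [Complex.norm_real, Real.norm_eq_abs, abs_of_pos (by linarith)]
      linarith)).trans (le_max_left _ _))
    (fun z _ hz => by
      have h3 : 1 < (((1 + η : ℝ) : ℂ) + z).re := by simp; linarith
      rw [hval _ h3]
      exact mul_ne_zero (sub_ne_zero.mpr (hne _ h3))
        (DirichletCharacter.LFunction_ne_zero_of_one_le_re _ (.inr (hne _ h3)) h3.le))
  rw [logDeriv_translate, add_zero, hval _ hσ] at this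
  have hev : DirichletCharacter.LFunctionTrivChar₁ 1 =ᶠ[nhds ((1 + η : ℝ) : ℂ)]
      fun s => (s - 1) * DirichletCharacter.LFunction (1 : DirichletCharacter ℂ 1) s := by
    filter_upwards [(isOpen_lt continuous_const continuous_re).mem_nhds hσ] with s hs using hval s hs
  have hl : logDeriv (DirichletCharacter.LFunctionTrivChar₁ 1) ((1 + η : ℝ) : ℂ) =
      ((1 / η : ℝ) : ℂ) +
      logDeriv (DirichletCharacter.LFunction (1 : DirichletCharacter ℂ 1)) (1 + η : ℝ) := by
    rw [logDeriv_apply, hev.deriv_eq, hev.eq_of_nhds, ← logDeriv_apply,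
      logDeriv_mul (f := fun s => s - 1) _ (sub_ne_zero.mpr (hne _ hσ))
        (DirichletCharacter.LFunction_ne_zero_of_one_le_re _ (.inr (hne _ hσ)) hσ.le) (by fun_prop)
        (DirichletCharacter.differentiableAt_LFunction _ _ (.inl (hne _ hσ)))]
    congr 1
    simp [logDeriv_apply]
  have hnm : ‖((1 + η : ℝ) : ℂ) - 1‖ = η := by
    simp [abs_of_pos h1]
  rw [hl, norm_mul, hnm, Complex.add_re, Complex.ofReal_re] at this
  norm_num at this ⊢
  linarith

end LandauPage

set_option maxHeartbeats 2000000 in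
/-- There is `c₄ > 0` such that for every `X ≥ 3` there is at most one modulus `k ∈ [3, X]`
admitting a real primitive Dirichlet character `χ₁` mod `k` whose L-function has a real zero
`β₁ ≥ 1 − c₄ / log X`. -/
theorem at_most_one_exceptional_modulus :
    ∃ c₄ : ℝ, 0 < c₄ ∧ ∀ X : ℝ, 3 ≤ X →
      ∀ (k : ℕ) [NeZero k] (k' : ℕ) [NeZero k'],
        3 ≤ k → (k : ℝ) ≤ X → 3 ≤ k' → (k' : ℝ) ≤ X →
        ∀ (χ : DirichletCharacter ℂ k) (χ' : DirichletCharacter ℂ k'),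
          χ.IsPrimitive → (∀ n : ZMod k, (χ n).im = 0) →
          χ'.IsPrimitive → (∀ n : ZMod k', (χ' n).im = 0) →
          (∃ β : ℝ, 1 - c₄ / Real.log X ≤ β ∧ DirichletCharacter.LFunction χ (β : ℂ) = 0) →
          (∃ β' : ℝ, 1 - c₄ / Real.log X ≤ β' ∧ DirichletCharacter.LFunction χ' (β' : ℂ) = 0) →
          k = k' := by
  obtain ⟨M, hM1, hM⟩ := LandauPage.Z_A
  have hC : 0 ≤ Real.log (64 * M) := Real.log_nonneg (by linarith)
  obtain ⟨y, hy1, hy2⟩ : ∃ y : ℝ, 100 + 20 * Real.log (64 * M) ≤ y ∧ Real.log y ≤ y / 100 := by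
    have h1 := Real.isLittleO_log_id_atTop.bound (c := 1 / 100) (by norm_num)
    obtain ⟨y, h1, h2⟩ := (h1.and (Filter.eventually_ge_atTop (100 + 20 * Real.log (64 * M)))).exists
    refine ⟨y, h2, ?_⟩
    have hy : 0 ≤ y := by linarith
    simp only [Real.norm_eq_abs, id, abs_of_nonneg hy] at h1
    linarith [le_abs_self (Real.log y)]
  have hy0 : 0 < y := by linarith
  refine ⟨1 / (8 * y), by positivity, ?_⟩
  intro X hX k _ k' _ hk hkX hk' hkX' χ χ' hp hr hp' hr' ⟨β, hβ, hβ0⟩ ⟨β', hβ', hβ0'⟩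
  by_contra hne
  have hL : 1 ≤ Real.log X := by
    rw [Real.le_log_iff_exp_le (by linarith)]
    linarith [Real.exp_one_lt_d9]
  obtain ⟨L, hLdef⟩ : ∃ L, L = Real.log X := ⟨_, rfl⟩
  rw [← hLdef] at hL hβ hβ'
  obtain ⟨η, hη⟩ : ∃ η : ℝ, η = 1 / (y * L) := ⟨_, rfl⟩
  have hηpos : 0 < η := by rw [hη]; positivity
  have hη4 : η ≤ 1 / 100 := by
    rw [hη]; apply one_div_le_one_div_of_le (by norm_num); nlinarith
  have hc4 : 1 / (8 * y) / L = η / 8 := by rw [hη]; field_simp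
  rw [hc4] at hβ hβ'
  have hχ : χ ≠ 1 := by
    rintro rfl
    have h1 : DirichletCharacter.conductor (1 : DirichletCharacter ℂ k) = k := hp
    rw [DirichletCharacter.conductor_one] at h1
    omega
  have hχ' : χ' ≠ 1 := by
    rintro rfl
    have h1 : DirichletCharacter.conductor (1 : DirichletCharacter ℂ k') = k' := hp'
    rw [DirichletCharacter.conductor_one] at h1
    omega
  have hψ := LandauPage.prodChar_ne_one hp hp' hne
  have s1 : 1 < 1 + η := by linarith
  have s2 : 1 + η ≤ 3 / 2 := by linarith
  obtain ⟨d1, e1⟩ := LandauPage.L_B hχ s1 s2 hβ0 (by linarith)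
  obtain ⟨d2, e2⟩ := LandauPage.L_B hχ' s1 s2 hβ0' (by linarith)
  have e3 := LandauPage.L_A hψ s1 s2
  have e4 := hM η hηpos (by linarith)
  have e5 := LandauPage.logDeriv_sum_nonpos hr hr' s1
  have e6 := LandauPage.one_le_norm_prod hr hr' s1
  generalize ‖DirichletCharacter.LFunction (1 : DirichletCharacter ℂ 1) (1 + η : ℝ)‖ = z at *
  have hn1 : 0 ≤ ‖DirichletCharacter.LFunction χ (1 + η : ℝ)‖ := norm_nonneg _
  have hn2 : 0 ≤ ‖DirichletCharacter.LFunction χ' (1 + η : ℝ)‖ := norm_nonneg _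
  have hn3 : 0 ≤ ‖DirichletCharacter.LFunction (LandauPage.prodChar χ χ') (1 + η : ℝ)‖ := norm_nonneg _
  generalize ‖DirichletCharacter.LFunction χ (1 + η : ℝ)‖ = u at *
  generalize ‖DirichletCharacter.LFunction χ' (1 + η : ℝ)‖ = v at *
  generalize ‖DirichletCharacter.LFunction (LandauPage.prodChar χ χ') (1 + η : ℝ)‖ = w at *
  have hz0 : z ≠ 0 := by rintro rfl; norm_num at e6
  have hu0 : u ≠ 0 := by rintro rfl; norm_num at e6
  have hv0 : v ≠ 0 := by rintro rfl; norm_num at e6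
  have hw0 : w ≠ 0 := by rintro rfl; norm_num at e6
  have hk0 : (0 : ℝ) < k := by exact_mod_cast (by omega : 0 < k)
  have hk0' : (0 : ℝ) < k' := by exact_mod_cast (by omega : 0 < k')
  have hX0 : 0 < X := by linarith
  have hlog : Real.log (M / (η * z)) + Real.log (4 * k / u) + Real.log (4 * k' / v) +
      Real.log (4 * (k * k' : ℕ) / w) ≤ Real.log (64 * M) + 4 * L + (L + y / 100) := by
    have hkk : ((k * k' : ℕ) : ℝ) ≠ 0 := by push_cast; positivity
    rw [← Real.log_mul (by positivity) (by positivity), ← Real.log_mul (by positivity) (by positivity),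
      ← Real.log_mul (by positivity) (by positivity)]
    have h1 : M / (η * z) * (4 * k / u) * (4 * k' / v) * (4 * (k * k' : ℕ) / w) =
        (64 * M * (k ^ 2 * k' ^ 2) / η) / (z * u * v * w) := by
      push_cast; field_simp; ring
    rw [h1]
    have h2 : (64 * M * (k ^ 2 * k' ^ 2) / η) / (z * u * v * w) ≤ 64 * M * (X ^ 2 * X ^ 2) * (y * L) := by
      have h3 : (64 * M * (k ^ 2 * k' ^ 2) / η) / (z * u * v * w) ≤ 64 * M * (k ^ 2 * k' ^ 2) / η :=
        div_le_self (by positivity) e6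
      refine h3.trans ?_
      have h4 : 64 * M * ((k : ℝ) ^ 2 * k' ^ 2) / η = 64 * M * (k ^ 2 * k' ^ 2) * (y * L) := by
        rw [hη]; field_simp
      rw [h4]
      gcongr
    have h5 : 0 < (64 * M * ((k : ℝ) ^ 2 * k' ^ 2) / η) / (z * u * v * w) := by
      have : 0 < z * u * v * w := by linarith
      positivity
    refine (Real.log_le_log h5 h2).trans ?_
    rw [Real.log_mul (by positivity) (by positivity), Real.log_mul (by positivity) (by positivity),
      Real.log_mul (x := X ^ 2) (by positivity) (by positivity), Real.log_mul hy0.ne' (by positivity), Real.log_pow, ← hLdef]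
    have h6 : Real.log L ≤ L - 1 := Real.log_le_sub_one_of_pos (by linarith)
    push_cast
    linarith
  have g1 : 8 / (9 * η) ≤ 1 / (1 + η - β) := by
    rw [div_le_div_iff₀ (by positivity) d1]; linarith
  have g2 : 8 / (9 * η) ≤ 1 / (1 + η - β') := by
    rw [div_le_div_iff₀ (by positivity) d2]; linarith
  have g3 : 8 / (9 * η) = 8 / 9 * (y * L) := by rw [hη]; field_simp
  have g4 : 1 / η = y * L := by rw [hη]; field_simp
  rw [g3] at g1 g2
  rw [g4] at e4
  have hfin : 7 / 9 * (y * L) ≤ 4 + 8 * (Real.log (64 * M) + 4 * L + (L + y / 100)) := by linarith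
  have q1 : y ≤ y * L := by nlinarith
  have q2 : Real.log (64 * M) ≤ Real.log (64 * M) * L := by nlinarith
  have q3 : (100 + 20 * Real.log (64 * M)) * L ≤ y * L := by gcongr
  nlinarith
end
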